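/- arXiv:math/0607475 — 5 statements merged into one kernel-verified Lean document; each statement's English description precedes it below -/
import Mathlib

section
/- Fix integers s ≥ 1 and i ≥ 0, and set r = 2s + si + i, g = rs + s, d = rs + r. Then (i+1)·C(r+2, i+2) = C(r, i)·(2d − i(s+1) + 1 − g), where C(n,k) denotes the binomial coefficient. (Note that d = r(s+1), so i·d/r = i(s+1).) -/
/-- Equality of the ranks of the vector bundles `𝒜` and `ℬ` in Theorem 1.1 of the
paper: for `s ≥ 1`, `i ≥ 0`, with `r = 2s + si + i`, `g = rs + s`, `d = rs + r`,
one has `(i+1)·C(r+2, i+2) = C(r, i)·(2d − i(s+1) + 1 − g)`. -/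
theorem rank_A_eq_rank_B (s i : ℕ) (hs : 1 ≤ s) (r g d : ℕ)
    (hr : r = 2 * s + s * i + i) (hg : g = r * s + s) (hd : d = r * s + r) :
    ((i + 1) * Nat.choose (r + 2) (i + 2) : ℤ) =
      (Nat.choose r i : ℤ) * (2 * (d : ℤ) - (i : ℤ) * ((s : ℤ) + 1) + 1 - (g : ℤ)) := by
  subst hg hd
  have h₁ : ((r : ℤ) + 1) * r.choose i = (r + 1).choose (i + 1) * ((i : ℤ) + 1) := by
    exact_mod_cast Nat.add_one_mul_choose_eq r i
  have h₂ : ((r : ℤ) + 2) * (r + 1).choose (i + 1) = (r + 2).choose (i + 2) * ((i : ℤ) + 2) := by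
    exact_mod_cast Nat.add_one_mul_choose_eq (r + 1) (i + 1)
  have hr' : (r : ℤ) = 2 * s + s * i + i := by exact_mod_cast hr
  have hi : (i : ℤ) + 2 ≠ 0 := by positivity
  apply mul_right_cancel₀ hi
  push_cast
  linear_combination (-(i : ℤ) - 1) * h₂ - ((r : ℤ) + 2) * h₁ +
    (r.choose i : ℤ) * ((r : ℤ) + 1 - (i + 2)) * hr'
end

section
/- Define f(s,i) = (i^4+8i^3+24i^2+32i+16)s^7+(i^4+4i^3−16i−16)s^6−(i^4+7i^3+13i^2−12)s^5−(i^4+2i^3+i^2+14i+24)s^4+(2i^3+2i^2−6i−4)s^3+(i^3+17i^2+50i+41)s^2+(7i^2+18i+9)s+2i+2 and h(s,i) = (i^3+6i^2+12i+8)s^6+(i^3+2i^2−4i−8)s^5−(i^3+7i^2+11i+2)s^4−(i^3−5i)s^3+(4i^2+5i+1)s^2+(i^2+7i+11)s+4i+2. Then for all integers s ≥ 2 and i ≥ 0, setting g = s(2s+si+i+1), one has h(s,i) > 0 and 6 < 6·f(s,i)/((i+2)·s·h(s,i)) < 6 + 12/(g+1). -/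
/-- The polynomial `f(s,i)` from Theorem 1.1 of the paper. -/
def fpoly (s i : ℤ) : ℤ :=
  (i^4 + 8*i^3 + 24*i^2 + 32*i + 16) * s^7 + (i^4 + 4*i^3 - 16*i - 16) * s^6
    - (i^4 + 7*i^3 + 13*i^2 - 12) * s^5 - (i^4 + 2*i^3 + i^2 + 14*i + 24) * s^4
    + (2*i^3 + 2*i^2 - 6*i - 4) * s^3 + (i^3 + 17*i^2 + 50*i + 41) * s^2
    + (7*i^2 + 18*i + 9) * s + 2*i + 2

/-- The polynomial `h(s,i)` from Theorem 1.1 of the paper. -/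
def hpoly (s i : ℤ) : ℤ :=
  (i^3 + 6*i^2 + 12*i + 8) * s^6 + (i^3 + 2*i^2 - 4*i - 8) * s^5
    - (i^3 + 7*i^2 + 11*i + 2) * s^4 - (i^3 - 5*i) * s^3
    + (4*i^2 + 5*i + 1) * s^2 + (i^2 + 7*i + 11) * s + 4*i + 2

theorem hpoly_pos {s i : ℤ} (hs : 2 ≤ s) (hi : 0 ≤ i) : 0 < hpoly s i := by
  obtain ⟨t, ht, rfl⟩ : ∃ t : ℤ, 0 ≤ t ∧ s = t + 2 := ⟨s - 2, by lia, by ring⟩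
  unfold hpoly
  ring_nf
  positivity

theorem mul_hpoly_lt_fpoly {s i : ℤ} (hs : 2 ≤ s) (hi : 0 ≤ i) :
    (i + 2) * s * hpoly s i < fpoly s i := by
  obtain ⟨t, ht, rfl⟩ : ∃ t : ℤ, 0 ≤ t ∧ s = t + 2 := ⟨s - 2, by lia, by ring⟩
  rw [← sub_pos]
  unfold hpoly fpoly
  ring_nf
  positivity

theorem fpoly_sub_mul_lt {s i : ℤ} (hs : 2 ≤ s) (hi : 0 ≤ i) :
    (fpoly s i - (i + 2) * s * hpoly s i) * (s * (2 * s + s * i + i + 1) + 1) <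
      2 * ((i + 2) * s * hpoly s i) := by
  obtain ⟨t, ht, rfl⟩ : ∃ t : ℤ, 0 ≤ t ∧ s = t + 2 := ⟨s - 2, by lia, by ring⟩
  rw [← sub_pos]
  unfold hpoly fpoly
  ring_nf
  positivity

/-- For all integers `s ≥ 2` and `i ≥ 0`, with `g = s(2s+si+i+1)`, one has
`h(s,i) > 0` and `6 < 6·f(s,i)/((i+2)·s·h(s,i)) < 6 + 12/(g+1)`: the slope of the
virtual Koszul divisor violates the Harris–Morrison Slope Conjecture. -/
theorem koszul_slope_bounds (s i : ℤ) (hs : 2 ≤ s) (hi : 0 ≤ i)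
    (g : ℤ) (hg : g = s * (2 * s + s * i + i + 1)) :
    0 < hpoly s i ∧
      6 < 6 * (fpoly s i : ℚ) / (((i : ℚ) + 2) * (s : ℚ) * (hpoly s i : ℚ)) ∧
      6 * (fpoly s i : ℚ) / (((i : ℚ) + 2) * (s : ℚ) * (hpoly s i : ℚ))
        < 6 + 12 / ((g : ℚ) + 1) := by
  have hpos := hpoly_pos hs hi
  have hden : (0 : ℚ) < ((i : ℚ) + 2) * s * hpoly s i := by
    have : 0 < (i + 2) * s * hpoly s i := by positivity
    exact_mod_cast this
  have hlow : ((i : ℚ) + 2) * s * hpoly s i < fpoly s i := by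
    exact_mod_cast mul_hpoly_lt_fpoly hs hi
  have hupp : ((fpoly s i : ℚ) - ((i : ℚ) + 2) * s * hpoly s i) * ((g : ℚ) + 1) <
      2 * (((i : ℚ) + 2) * s * hpoly s i) := by
    have := fpoly_sub_mul_lt hs hi
    rw [← hg] at this
    exact_mod_cast this
  have hg1 : (0 : ℚ) < (g : ℚ) + 1 := by
    have : 0 < g + 1 := by rw [hg]; positivity
    exact_mod_cast this
  refine ⟨hpos, ?_, ?_⟩
  · rw [lt_div_iff₀ hden]
    linarith
  · have : (6 : ℚ) + 12 / ((g : ℚ) + 1) = (6 * (g + 1) + 12) / (g + 1) := by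
      field_simp
    rw [this, div_lt_div_iff₀ hden hg1]
    linarith
end

section
/- For every integer s ≥ 2 one has 6 < 3(16s^7−16s^6+12s^5−24s^4−4s^3+41s^2+9s+2)/(s(8s^6−8s^5−2s^4+s^2+11s+2)) < 6 + 12/(s(2s+1)+1). -/
/-- For every integer `s ≥ 2`, the slope of the divisor `Z_{g,0}` on `M̄_g`,
`g = s(2s+1)` (Theorems 1.3 and 1.4 of the paper), satisfies
`6 < 3(16s⁷−16s⁶+12s⁵−24s⁴−4s³+41s²+9s+2)/(s(8s⁶−8s⁵−2s⁴+s²+11s+2)) < 6 + 12/(g+1)`,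
giving an infinite sequence of counterexamples to the Slope Conjecture. -/
theorem quadric_divisor_slope_bounds (s : ℤ) (hs : 2 ≤ s) :
    6 < 3 * (16*(s : ℚ)^7 - 16*(s : ℚ)^6 + 12*(s : ℚ)^5 - 24*(s : ℚ)^4
          - 4*(s : ℚ)^3 + 41*(s : ℚ)^2 + 9*(s : ℚ) + 2) /
        ((s : ℚ) * (8*(s : ℚ)^6 - 8*(s : ℚ)^5 - 2*(s : ℚ)^4 + (s : ℚ)^2
          + 11*(s : ℚ) + 2)) ∧
      3 * (16*(s : ℚ)^7 - 16*(s : ℚ)^6 + 12*(s : ℚ)^5 - 24*(s : ℚ)^4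
          - 4*(s : ℚ)^3 + 41*(s : ℚ)^2 + 9*(s : ℚ) + 2) /
        ((s : ℚ) * (8*(s : ℚ)^6 - 8*(s : ℚ)^5 - 2*(s : ℚ)^4 + (s : ℚ)^2
          + 11*(s : ℚ) + 2))
        < 6 + 12 / ((s : ℚ) * (2*(s : ℚ) + 1) + 1) := by
  have hs' : (2 : ℚ) ≤ (s : ℚ) := by exact_mod_cast hs
  obtain ⟨t, ht, hst⟩ : ∃ t : ℚ, 0 ≤ t ∧ (s : ℚ) = t + 2 :=
    ⟨s - 2, by linarith, by ring⟩
  rw [hst]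
  have hD : 0 < (t + 2) * (8 * (t + 2)^6 - 8 * (t + 2)^5 - 2 * (t + 2)^4 + (t + 2)^2
      + 11 * (t + 2) + 2) := by
    ring_nf
    positivity
  have hg : 0 < (t + 2) * (2 * (t + 2) + 1) + 1 := by positivity
  constructor
  · rw [lt_div_iff₀ hD, ← sub_pos]
    ring_nf
    positivity
  · rw [← sub_lt_iff_lt_add', div_sub' hD.ne', div_lt_div_iff₀ hD hg, ← sub_pos]
    ring_nf
    positivity
end

section
/- Let s ≥ 2 be an integer and let j be an integer with s(2s+1) ≤ 2j and j ≤ s(2s−1). Then 4(s−1)·j·(2js^3+js^2−2js−2j+4s^3+4s^2−3s)·(2s^2+s−j) / ((2s^2+s−2)(3s+1)(2s−1)(j−1)) ≥ s(8s^6−8s^5−2s^4+s^2+11s+2) / (3(2s^2+s−2)(3s+1)(2s−1)). -/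
/-- The polynomial inequality behind `delta_j_coefficient_ge_delta_0`, after clearing
denominators. -/
theorem delta_coefficient_cleared_inequality {s j : ℚ} (hs : 2 ≤ s)
    (hj1 : s * (2 * s + 1) ≤ 2 * j) (hj2 : j ≤ s * (2 * s - 1)) :
    s * (8*s^6 - 8*s^5 - 2*s^4 + s^2 + 11*s + 2) * (j - 1) ≤
      12 * (s - 1) * j * (2*j*s^3 + j*s^2 - 2*j*s - 2*j + 4*s^3 + 4*s^2 - 3*s) *
        (2*s^2 + s - j) := by
  obtain ⟨t, rfl⟩ : ∃ t, s = t + 2 := ⟨s - 2, by ring⟩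
  have ht : 0 ≤ t := by linarith
  set s := t + 2 with hst
  have hj : 1 ≤ j := by nlinarith
  set A : ℚ := 2*s^3 + s^2 - 2*s - 2
  set B : ℚ := 4*s^3 + 4*s^2 - 3*s
  set P : ℚ := 8*s^6 - 8*s^5 - 2*s^4 + s^2 + 11*s + 2
  have hA : 0 ≤ A := by
    have : A = 2*t^3 + 13*t^2 + 26*t + 14 := by simp only [A, hst]; ring
    rw [this]; positivity
  have hB : 0 ≤ B := by
    have : B = 4*t^3 + 28*t^2 + 61*t + 42 := by simp only [B, hst]; ring
    rw [this]; positivity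
  have hs1 : 0 ≤ s - 1 := by linarith
  have hP : P ≤ 12 * (s - 1) * (A * (s * (2 * s + 1)) + 2 * B) := by
    rw [← sub_nonneg]
    simp only [A, B, P, hst]
    ring_nf
    positivity
  have hlin : A * (s * (2 * s + 1)) + 2 * B ≤ 2 * (A * j + B) := by
    nlinarith [mul_le_mul_of_nonneg_left hj1 hA]
  have hgap : 2 * s ≤ 2*s^2 + s - j := by linarith
  have hAj : 0 ≤ A * j + B := by positivity
  have hX : s * P ≤ 12 * (s - 1) * (A * j + B) * (2*s^2 + s - j) :=
    calc s * P ≤ s * (12 * (s - 1) * (2 * (A * j + B))) := by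
          gcongr
          exact hP.trans (by gcongr)
      _ = 12 * (s - 1) * (A * j + B) * (2 * s) := by ring
      _ ≤ _ := by gcongr
  have hX0 : 0 ≤ 12 * (s - 1) * (A * j + B) * (2*s^2 + s - j) := by
    have : 0 ≤ 2*s^2 + s - j := by linarith
    positivity
  calc s * P * (j - 1)
      ≤ 12 * (s - 1) * (A * j + B) * (2*s^2 + s - j) * (j - 1) :=
        mul_le_mul_of_nonneg_right hX (by linarith)
    _ ≤ 12 * (s - 1) * (A * j + B) * (2*s^2 + s - j) * j :=
        mul_le_mul_of_nonneg_left (by linarith) hX0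
    _ = _ := by simp only [A, B]; ring

/-- The inequality `B_j/c_r ≥ B_0/c_r` from the proof of Theorem 1.3 of the paper:
for integers `s ≥ 2` and `j` with `s(2s+1) ≤ 2j` and `j ≤ s(2s−1)`, one has
`4(s−1)j(2js³+js²−2js−2j+4s³+4s²−3s)(2s²+s−j)/((2s²+s−2)(3s+1)(2s−1)(j−1))`
`≥ s(8s⁶−8s⁵−2s⁴+s²+11s+2)/(3(2s²+s−2)(3s+1)(2s−1))`. -/
theorem delta_j_coefficient_ge_delta_0 (s j : ℤ) (hs : 2 ≤ s)
    (hj1 : s * (2 * s + 1) ≤ 2 * j) (hj2 : j ≤ s * (2 * s - 1)) :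
    4 * ((s : ℚ) - 1) * (j : ℚ) *
        (2*(j : ℚ)*(s : ℚ)^3 + (j : ℚ)*(s : ℚ)^2 - 2*(j : ℚ)*(s : ℚ) - 2*(j : ℚ)
          + 4*(s : ℚ)^3 + 4*(s : ℚ)^2 - 3*(s : ℚ)) *
        (2*(s : ℚ)^2 + (s : ℚ) - (j : ℚ)) /
        ((2*(s : ℚ)^2 + (s : ℚ) - 2) * (3*(s : ℚ) + 1) * (2*(s : ℚ) - 1) * ((j : ℚ) - 1))
      ≥ (s : ℚ) * (8*(s : ℚ)^6 - 8*(s : ℚ)^5 - 2*(s : ℚ)^4 + (s : ℚ)^2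
          + 11*(s : ℚ) + 2) /
        (3 * (2*(s : ℚ)^2 + (s : ℚ) - 2) * (3*(s : ℚ) + 1) * (2*(s : ℚ) - 1)) := by
  have hs' : (2 : ℚ) ≤ s := by exact_mod_cast hs
  have hj1' : (s : ℚ) * (2 * s + 1) ≤ 2 * j := by exact_mod_cast hj1
  have hj2' : (j : ℚ) ≤ s * (2 * s - 1) := by exact_mod_cast hj2
  have key := delta_coefficient_cleared_inequality hs' hj1' hj2'
  have hj : (0 : ℚ) < j - 1 := by nlinarith
  have h1 : (0 : ℚ) < 2 * (s : ℚ)^2 + s - 2 := by nlinarith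
  have h2 : (0 : ℚ) < 3 * (s : ℚ) + 1 := by linarith
  have h3 : (0 : ℚ) < 2 * (s : ℚ) - 1 := by linarith
  rw [ge_iff_le, div_le_div_iff₀ (by positivity) (by positivity)]
  linear_combination
    ((2 * (s : ℚ)^2 + s - 2) * (3 * (s : ℚ) + 1) * (2 * (s : ℚ) - 1)) * key
end

section
/- For all integers r ≥ 1 and s ≥ 1, set g = rs + s, a(r,s) = r^2 s^2 (4s+r+rs+10) + s^2(5rs+24r+2s+15) + 21s+26rs+7r^2 s+2r+2 and b_0(r,s) = s(s+1)(r+1)(r+2)(rs+s+4)/6. Then b_0(r,s) > 0 and a(r,s)/b_0(r,s) ≥ 6 + 12/(g+1). -/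
/-- The λ-coefficient `a(r,s)` of the Gieseker–Petri divisor (Theorem 1.5). -/
def gpA (r s : ℤ) : ℤ :=
  r^2 * s^2 * (4*s + r + r*s + 10) + s^2 * (5*r*s + 24*r + 2*s + 15)
    + 21*s + 26*r*s + 7*r^2*s + 2*r + 2

/-- The δ₀-coefficient `b₀(r,s)` of the Gieseker–Petri divisor (Theorem 1.5). -/
def gpB0 (r s : ℤ) : ℚ :=
  ((s * (s+1) * (r+1) * (r+2) * (r*s + s + 4) : ℤ) : ℚ) / 6

/-- The slope bound for the Gieseker–Petri divisors, with denominators cleared. -/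
theorem gpA_mul_ge {r s : ℤ} (hr : 1 ≤ r) (hs : 1 ≤ s) :
    s * (s + 1) * (r + 1) * (r + 2) * (r * s + s + 4) * (r * s + s + 3)
      ≤ gpA r s * (r * s + s + 1) := by
  obtain ⟨x, rfl⟩ := Int.le.dest hr
  obtain ⟨y, rfl⟩ := Int.le.dest hs
  rw [← sub_nonneg, gpA]
  ring_nf
  positivity

/-- The Gieseker–Petri divisors satisfy the Harris–Morrison Slope Conjecture
bound: with `g = rs + s`, one has `b₀(r,s) > 0` and `a(r,s)/b₀(r,s) ≥ 6 + 12/(g+1)`. -/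
theorem gp_slope_satisfies_slope_conjecture (r s : ℤ) (hr : 1 ≤ r) (hs : 1 ≤ s)
    (g : ℤ) (hg : g = r * s + s) :
    0 < gpB0 r s ∧ (gpA r s : ℚ) / gpB0 r s ≥ 6 + 12 / ((g : ℚ) + 1) := by
  subst hg
  have hN : (0 : ℚ) < ((s * (s + 1) * (r + 1) * (r + 2) * (r * s + s + 4) : ℤ) : ℚ) := by
    have : 0 < s * (s + 1) * (r + 1) * (r + 2) * (r * s + s + 4) := by positivity
    exact_mod_cast this
  have hg : (0 : ℚ) < ((r * s + s : ℤ) : ℚ) + 1 := by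
    have : 0 < r * s + s + 1 := by positivity
    exact_mod_cast this
  have hb : 0 < gpB0 r s := div_pos hN (by norm_num)
  have key : ((s * (s + 1) * (r + 1) * (r + 2) * (r * s + s + 4) : ℤ) : ℚ)
      * (((r * s + s : ℤ) : ℚ) + 3) ≤ gpA r s * (((r * s + s : ℤ) : ℚ) + 1) := by
    exact_mod_cast gpA_mul_ge hr hs
  refine ⟨hb, ?_⟩
  have hsum : (6 : ℚ) + 12 / (((r * s + s : ℤ) : ℚ) + 1)
      = 6 * (((r * s + s : ℤ) : ℚ) + 3) / (((r * s + s : ℤ) : ℚ) + 1) := by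
    field_simp
    ring
  rw [ge_iff_le, hsum, div_le_div_iff₀ hg hb, gpB0]
  linarith
end
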